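/- arXiv:2211.15484 — 3 statements merged into one kernel-verified Lean document; each statement's English description precedes it below -/
import Mathlib

section
/- Let m ≥ 1, let T ∈ ℝ^{m×m} be symmetric and idempotent (T' = T and T·T = T), let Σ₀ ∈ ℝ^{m×m} be a symmetric positive definite matrix, and let q ∈ ℝ^m satisfy Tq ≠ 0. Let P ∈ ℝ^{m×m} be any matrix satisfying the four Penrose equations for M := T·Σ₀·T, namely M·P·M = M, P·M·P = P, (M·P)' = M·P, and (P·M)' = P·M. Then the quadratic form (Tq)'·P·(Tq) is strictly positive. -/
open Matrix

/-- The quadratic form of the compression `T * S * T` by a symmetric `T`. -/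
theorem dotProduct_compression_mulVec {n : Type*} [Fintype n] {T S : Matrix n n ℝ}
    (hT : Tᵀ = T) (v : n → ℝ) :
    v ⬝ᵥ (T * S * T) *ᵥ v = T *ᵥ v ⬝ᵥ S *ᵥ (T *ᵥ v) := by
  rw [← mulVec_mulVec, ← mulVec_mulVec, dotProduct_mulVec, ← mulVec_transpose, hT]

/-- A compression `T * S * T` of a positive definite matrix has positive quadratic form off the
kernel of `T`. -/
theorem dotProduct_compression_mulVec_pos {n : Type*} [Fintype n] {T S : Matrix n n ℝ}
    (hT : Tᵀ = T) (hS : S.PosDef) {v : n → ℝ} (hv : T *ᵥ v ≠ 0) :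
    0 < v ⬝ᵥ (T * S * T) *ᵥ v := by
  rw [dotProduct_compression_mulVec hT]
  simpa using hS.dotProduct_mulVec_pos hv

/-- If `M = T * S * T` with `T` an orthogonal projection and `S` positive definite, then `M * P`
fixes the range of `T` for every `P` with `M * P * M = M` and `M * P` symmetric. -/
theorem compression_mul_mulVec_eq_self {n : Type*} [Fintype n] {T S P : Matrix n n ℝ}
    (hT : Tᵀ = T) (hTT : T * T = T) (hS : S.PosDef) (hSsymm : Sᵀ = S)
    (h₁ : (T * S * T) * P * (T * S * T) = T * S * T)
    (h₂ : ((T * S * T) * P)ᵀ = (T * S * T) * P) (q : n → ℝ) :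
    ((T * S * T) * P) *ᵥ (T *ᵥ q) = T *ᵥ q := by
  have hTM : T * (T * S * T) = T * S * T := by simp only [← mul_assoc, hTT]
  have hMsymm : (T * S * T)ᵀ = T * S * T := by
    simp only [transpose_mul, hT, hSsymm, mul_assoc]
  have hMMP : (T * S * T) * ((T * S * T) * P) = T * S * T := by
    have h := congrArg transpose h₁
    rwa [transpose_mul, h₂, hMsymm] at h
  set M := T * S * T with hM
  have hMw : M *ᵥ (T *ᵥ q - (M * P) *ᵥ (T *ᵥ q)) = 0 := by
    rw [mulVec_sub, mulVec_mulVec _ M (M * P), hMMP, sub_self]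
  have hTw : T *ᵥ (T *ᵥ q - (M * P) *ᵥ (T *ᵥ q)) = T *ᵥ q - (M * P) *ᵥ (T *ᵥ q) := by
    rw [mulVec_sub, mulVec_mulVec _ T T, hTT, mulVec_mulVec _ T (M * P), ← mul_assoc, hTM]
  by_contra hne
  have hpos := dotProduct_compression_mulVec_pos hT hS
    (v := T *ᵥ q - (M * P) *ᵥ (T *ᵥ q)) (by
      rw [hTw]
      exact sub_ne_zero.mpr (Ne.symm hne))
  rw [← hM, hMw, dotProduct_zero] at hpos
  exact hpos.false

/-- If `T` is symmetric idempotent, `Σ₀` is symmetric positive definite, `Tq ≠ 0`,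
and `P` is a Moore–Penrose inverse of `M = T·Σ₀·T` (i.e. satisfies the four Penrose
equations), then the quadratic form `(Tq)' P (Tq)` is strictly positive. -/
theorem quadratic_form_moorePenrose_pos
    (m : ℕ) (hm : 1 ≤ m)
    (T S0 P : Matrix (Fin m) (Fin m) ℝ)
    (hTsymm : Tᵀ = T) (hTidem : T * T = T)
    (hS0symm : S0ᵀ = S0) (hS0posdef : S0.PosDef)
    (q : Fin m → ℝ) (hq : T.mulVec q ≠ 0)
    (hP1 : (T * S0 * T) * P * (T * S0 * T) = T * S0 * T)
    (hP2 : P * (T * S0 * T) * P = P)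
    (hP3 : ((T * S0 * T) * P)ᵀ = (T * S0 * T) * P)
    (hP4 : (P * (T * S0 * T))ᵀ = P * (T * S0 * T)) :
    0 < T.mulVec q ⬝ᵥ P.mulVec (T.mulVec q) := by
  have hfix := compression_mul_mulVec_eq_self hTsymm hTidem hS0posdef hS0symm hP1 hP3 q
  rw [← mulVec_mulVec] at hfix
  have hTy : T *ᵥ (P *ᵥ (T *ᵥ q)) ≠ 0 := by
    intro h
    rw [← mulVec_mulVec _ (T * S0) T, h, mulVec_zero] at hfix
    exact hq hfix.symm
  have hpos := dotProduct_compression_mulVec_pos hTsymm hS0posdef hTy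
  rwa [hfix, dotProduct_comm] at hpos
end

section
/- Fix n ≥ 1, p ∈ (0,1], and set k := ⌈n·p⌉. Let Ω := (Fin n → Fin n) carry the uniform probability measure (i.e., ω(1),…,ω(n) are i.i.d. uniform on {1,…,n}, modelling drawing n times with replacement from a sample of n distinct values sorted increasingly). For j ∈ {1,…,n}, the probability of the event { ω : #{i : ω(i) ≤ j} ≥ k and #{i : ω(i) ≤ j−1} ≤ k−1 } (i.e., the k-th order statistic of the bootstrap sample equals the j-th order statistic of the original sample) equals P(B_{n,(j−1)/n} ≤ k−1) − P(B_{n,j/n} ≤ k−1), where B_{n,θ} denotes a binomial random variable with n trials and success probability θ. -/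
open MeasureTheory

/-- The functions hitting `P` at exactly `s` arguments are counted by a binomial formula. -/
theorem card_filter_card_filter_eq {ι α : Type*} [Fintype ι] [DecidableEq ι] [Fintype α]
    (P : α → Prop) [DecidablePred P] (s : ℕ) :
    (Finset.univ.filter fun ω : ι → α => (Finset.univ.filter fun i => P (ω i)).card = s).card =
      (Fintype.card ι).choose s * ((Finset.univ.filter P).card ^ s *
        (Finset.univ.filter fun a => ¬ P a).card ^ (Fintype.card ι - s)) := by
  classical
  rw [Finset.card_eq_sum_card_fiberwise (f := fun ω : ι → α => Finset.univ.filter fun i => P (ω i))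
    (t := Finset.powersetCard s Finset.univ) (by
      intro ω hω
      simpa [Finset.mem_powersetCard] using hω)]
  rw [Finset.sum_congr rfl (g := fun _ => (Finset.univ.filter P).card ^ s *
        (Finset.univ.filter fun a => ¬ P a).card ^ (Fintype.card ι - s))]
  · simp [Finset.card_powersetCard]
  · intro T hT
    have hTs : T.card = s := (Finset.mem_powersetCard.1 hT).2
    have hfiber : ((Finset.univ.filter fun ω : ι → α =>
          (Finset.univ.filter fun i => P (ω i)).card = s).filter
            fun ω => (Finset.univ.filter fun i => P (ω i)) = T) =
        Fintype.piFinset fun i =>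
          if i ∈ T then Finset.univ.filter P else Finset.univ.filter fun a => ¬ P a := by
      ext ω
      simp only [Finset.mem_filter, Finset.mem_univ, true_and, Fintype.mem_piFinset]
      constructor
      · rintro ⟨-, rfl⟩ i
        by_cases h : P (ω i) <;> simp [h]
      · intro h
        have hT' : (Finset.univ.filter fun i => P (ω i)) = T := by
          ext i
          have hi := h i
          by_cases hiT : i ∈ T <;> simp [hiT] at hi ⊢ <;> exact hi
        exact ⟨hT' ▸ hTs, hT'⟩
    rw [hfiber, Fintype.card_piFinset]
    simp only [apply_ite Finset.card]
    rw [Finset.prod_ite]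
    have hcompl : (Finset.univ.filter fun i => i ∉ T) = Tᶜ := by ext i; simp
    simp [hcompl, Finset.card_compl, hTs]

/-- The proportion of maps `Fin n → Fin n` with at most `r` values below `m` is the binomial
cumulative distribution function with success probability `m / n`. -/
theorem card_filter_card_lt_le_div_eq_sum (n : ℕ) (hn : 1 ≤ n) (m r : ℕ) (hm : m ≤ n) :
    ((Finset.univ.filter fun ω : Fin n → Fin n =>
        (Finset.univ.filter fun i => (ω i : ℕ) < m).card ≤ r).card : ℝ) / (n : ℝ) ^ n =
      ∑ s ∈ Finset.range (r + 1),
        (n.choose s : ℝ) * ((m : ℝ) / n) ^ s * (1 - (m : ℝ) / n) ^ (n - s) := by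
  have hn0 : (n : ℝ) ≠ 0 := by positivity
  have hlt : (Finset.univ.filter fun a : Fin n => (a : ℕ) < m).card = m := by
    simp [Fin.card_filter_val_lt, hm]
  have hge : (Finset.univ.filter fun a : Fin n => ¬ (a : ℕ) < m).card = n - m := by
    have h := Finset.card_filter_add_card_filter_not (s := (Finset.univ : Finset (Fin n)))
      (fun a : Fin n => (a : ℕ) < m)
    rw [hlt, Finset.card_univ, Fintype.card_fin] at h
    omega
  rw [Finset.card_eq_sum_card_fiberwise
    (f := fun ω : Fin n → Fin n => (Finset.univ.filter fun i => (ω i : ℕ) < m).card)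
    (t := Finset.range (r + 1)) (by
      intro ω hω
      simpa [Nat.lt_succ_iff] using hω), Nat.cast_sum, Finset.sum_div]
  refine Finset.sum_congr rfl fun s hs => ?_
  have hs' : s ≤ r := Nat.lt_succ_iff.1 (Finset.mem_range.1 hs)
  have hfilter : ((Finset.univ.filter fun ω : Fin n → Fin n =>
        (Finset.univ.filter fun i => (ω i : ℕ) < m).card ≤ r).filter
          fun ω => (Finset.univ.filter fun i => (ω i : ℕ) < m).card = s) =
      Finset.univ.filter fun ω : Fin n → Fin n =>
        (Finset.univ.filter fun i => (ω i : ℕ) < m).card = s := by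
    ext ω
    simp only [Finset.mem_filter, Finset.mem_univ, true_and]
    omega
  rw [hfilter, card_filter_card_filter_eq (fun a : Fin n => (a : ℕ) < m), hlt, hge,
    Fintype.card_fin]
  rcases le_or_gt s n with hsn | hsn
  · have hpow : (n : ℝ) ^ n = (n : ℝ) ^ s * (n : ℝ) ^ (n - s) := by
      rw [← pow_add, Nat.add_sub_cancel' hsn]
    have hsub : 1 - (m : ℝ) / n = ((n : ℝ) - m) / n := by field_simp
    rw [hpow, hsub, div_pow, div_pow]
    push_cast [Nat.cast_sub hm]
    field_simp
  · simp [Nat.choose_eq_zero_of_lt hsn]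

/-- Efron's bootstrap: drawing `n` indices i.i.d. uniformly from `{1,…,n}` (an element
`ω` of `Fin n → Fin n` under the uniform probability measure), the probability that the
`k`-th bootstrap order statistic equals the `j`-th original order statistic (at least `k`
draws with index `≤ j` and at most `k−1` draws with index `≤ j−1`) is
`P(B_{n,(j−1)/n} ≤ k−1) − P(B_{n,j/n} ≤ k−1)`. -/
theorem bootstrap_order_statistic_probability
    (n : ℕ) (hn : 1 ≤ n) (p : ℝ) (hp : p ∈ Set.Ioc (0 : ℝ) 1)
    (k : ℕ) (hk : k = ⌈(n : ℝ) * p⌉₊)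
    (μ : Measure (Fin n → Fin n)) [IsProbabilityMeasure μ]
    (hμ : ∀ ω : Fin n → Fin n, μ {ω} = ((n : ENNReal) ^ n)⁻¹)
    (count : (Fin n → Fin n) → ℕ → ℕ)
    (hcount : ∀ ω j, count ω j = (Finset.univ.filter fun i => (ω i : ℕ) < j).card)
    (j : ℕ) (hj : j ∈ Finset.Icc 1 n) :
    (μ {ω | k ≤ count ω j ∧ count ω (j - 1) ≤ k - 1}).toReal =
      (∑ s ∈ Finset.range ((k - 1) + 1),
        (n.choose s : ℝ) * (((j : ℝ) - 1) / n) ^ s * (1 - ((j : ℝ) - 1) / n) ^ (n - s))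
      - (∑ s ∈ Finset.range ((k - 1) + 1),
        (n.choose s : ℝ) * ((j : ℝ) / n) ^ s * (1 - (j : ℝ) / n) ^ (n - s)) := by
  have hn0 : (0 : ℝ) < n := by exact_mod_cast hn
  have hk1 : 1 ≤ k := by
    rw [hk]
    exact Nat.ceil_pos.2 (mul_pos hn0 hp.1)
  obtain ⟨hj1, hjn⟩ := Finset.mem_Icc.1 hj
  have hmono : ∀ ω, count ω (j - 1) ≤ count ω j := fun ω => by
    rw [hcount, hcount]
    refine Finset.card_le_card fun i hi => ?_
    simp only [Finset.mem_filter, Finset.mem_univ, true_and] at hi ⊢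
    omega
  have hμ_card : (μ {ω | k ≤ count ω j ∧ count ω (j - 1) ≤ k - 1}).toReal =
      ((Finset.univ.filter fun ω => k ≤ count ω j ∧ count ω (j - 1) ≤ k - 1).card : ℝ) /
        (n : ℝ) ^ n := by
    have hcoe : {ω | k ≤ count ω j ∧ count ω (j - 1) ≤ k - 1} =
        ((Finset.univ.filter fun ω => k ≤ count ω j ∧ count ω (j - 1) ≤ k - 1 :
          Finset (Fin n → Fin n)) : Set (Fin n → Fin n)) := by
      ext ω
      simp
    rw [hcoe, ← sum_measure_singleton, Finset.sum_congr rfl fun ω _ => hμ ω]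
    simp [div_eq_mul_inv]
  have hsplit : (Finset.univ.filter fun ω => count ω (j - 1) ≤ k - 1).card =
      (Finset.univ.filter fun ω => k ≤ count ω j ∧ count ω (j - 1) ≤ k - 1).card +
        (Finset.univ.filter fun ω => count ω j ≤ k - 1).card := by
    rw [← Finset.card_union_of_disjoint]
    · congr 1
      ext ω
      have := hmono ω
      simp only [Finset.mem_filter, Finset.mem_univ, true_and, Finset.mem_union]
      omega
    · rw [Finset.disjoint_filter]
      intro ω _ h
      omega
  have hprev := card_filter_card_lt_le_div_eq_sum n hn (j - 1) (k - 1) (by omega)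
  have hcurr := card_filter_card_lt_le_div_eq_sum n hn j (k - 1) hjn
  rw [Nat.cast_sub hj1, Nat.cast_one] at hprev
  simp only [← hcount] at hprev hcurr
  rw [hμ_card, ← hprev, ← hcurr, hsplit]
  push_cast
  ring
end

section
/- Let (Ω, 𝓐, P) be a probability space, m ≥ 1, T ∈ ℝ^{m×m} a fixed matrix, and q ∈ ℝ^m with T·q ≠ 0. Let q̂_n : Ω → ℝ^m be random vectors converging in probability to q, and let Ê_n : Ω → ℝ^{m×m} be random matrices converging in probability (entrywise) to a fixed matrix E ∈ ℝ^{m×m} satisfying (Tq)'·E·(Tq) > 0. Define S_n := n·(T·q̂_n)'·Ê_n·(T·q̂_n). Then S_n diverges to infinity in probability: for every M ∈ ℝ, P(S_n ≤ M) → 0 as n → ∞. -/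
open MeasureTheory Matrix Filter

/-- Near a point `(x, A)` where the quadratic form of `T *ᵥ x` in `A` exceeds `c`, it still
exceeds `c`; the neighbourhood is given by Euclidean distance and entrywise distance. -/
theorem exists_pos_forall_lt_mulVec_dotProduct {m : ℕ} (T : Matrix (Fin m) (Fin m) ℝ)
    (x : Fin m → ℝ) (A : Matrix (Fin m) (Fin m) ℝ) {c : ℝ}
    (hc : c < T.mulVec x ⬝ᵥ A.mulVec (T.mulVec x)) :
    ∃ ε : ℝ, 0 < ε ∧ ∀ (y : Fin m → ℝ) (B : Matrix (Fin m) (Fin m) ℝ),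
      Real.sqrt (∑ i, (y i - x i) ^ 2) ≤ ε → (∀ i j, |B i j - A i j| ≤ ε) →
        c < T.mulVec y ⬝ᵥ B.mulVec (T.mulVec y) := by
  have hcont : Continuous fun p : (Fin m → ℝ) × (Fin m → Fin m → ℝ) =>
      T.mulVec p.1 ⬝ᵥ (Matrix.of p.2).mulVec (T.mulVec p.1) := by
    simp only [dotProduct, mulVec, Matrix.of_apply]
    fun_prop
  have hnhds := hcont.continuousAt.eventually
    (lt_mem_nhds (show c < T.mulVec (x, fun i j => A i j).1 ⬝ᵥ
      (Matrix.of (x, fun i j => A i j).2).mulVec (T.mulVec (x, fun i j => A i j).1) from hc))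
  obtain ⟨ε, hε, hball⟩ := Metric.nhds_basis_closedBall.eventually_iff.1 hnhds
  refine ⟨ε, hε, fun y B hy hB => ?_⟩
  refine @hball (y, fun i j => B i j) ?_
  rw [Metric.mem_closedBall, Prod.dist_eq, max_le_iff]
  constructor
  · refine (dist_pi_le_iff hε.le).2 fun i => ?_
    rw [Real.dist_eq]
    refine (Real.abs_le_sqrt ?_).trans hy
    exact Finset.single_le_sum (f := fun i => (y i - x i) ^ 2) (fun _ _ => sq_nonneg _)
      (Finset.mem_univ i)
  · exact (dist_pi_le_iff hε.le).2 fun i => (dist_pi_le_iff hε.le).2 fun j => hB i j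

/-- Consistency of the quadratic-form statistic under the alternative: if `Tq ≠ 0`,
`q̂_n → q` in probability (Euclidean distance), `Ê_n → E` entrywise in probability and
`(Tq)'E(Tq) > 0`, then `S_n = n·(Tq̂_n)'Ê_n(Tq̂_n)` diverges to infinity in probability. -/
theorem quadratic_form_statistic_diverges_under_alternative
    (Ω : Type*) [MeasurableSpace Ω] (P : Measure Ω) [IsProbabilityMeasure P]
    (m : ℕ) (hm : 1 ≤ m)
    (T : Matrix (Fin m) (Fin m) ℝ) (q : Fin m → ℝ) (hTq : T.mulVec q ≠ 0)
    (qhat : ℕ → Ω → Fin m → ℝ)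
    (hqconv : ∀ ε : ℝ, 0 < ε →
      Tendsto (fun n =>
          P {ω | ε < Real.sqrt (∑ i, (qhat n ω i - q i) ^ 2)}) atTop (nhds 0))
    (Ehat : ℕ → Ω → Matrix (Fin m) (Fin m) ℝ) (E : Matrix (Fin m) (Fin m) ℝ)
    (hEconv : ∀ (i j : Fin m) (ε : ℝ), 0 < ε →
      Tendsto (fun n => P {ω | ε < |Ehat n ω i j - E i j|}) atTop (nhds 0))
    (hpos : 0 < T.mulVec q ⬝ᵥ E.mulVec (T.mulVec q))
    (S : ℕ → Ω → ℝ)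
    (hS : ∀ n ω, S n ω =
      (n : ℝ) * (T.mulVec (qhat n ω) ⬝ᵥ (Ehat n ω).mulVec (T.mulVec (qhat n ω)))) :
    ∀ M : ℝ, Tendsto (fun n => P {ω | S n ω ≤ M}) atTop (nhds 0) := by
  intro M
  obtain ⟨ε, hε, hlow⟩ := exists_pos_forall_lt_mulVec_dotProduct T q E (half_lt_self hpos)
  set c := (T.mulVec q ⬝ᵥ E.mulVec (T.mulVec q)) / 2
  have hc : 0 < c := half_pos hpos
  have hlim : Tendsto (fun n =>
      P {ω | ε < Real.sqrt (∑ i, (qhat n ω i - q i) ^ 2)} +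
        ∑ i, ∑ j, P {ω | ε < |Ehat n ω i j - E i j|}) atTop (nhds 0) := by
    simpa using (hqconv ε hε).add (tendsto_finsetSum Finset.univ fun i _ =>
      tendsto_finsetSum Finset.univ fun j _ => hEconv i j ε hε)
  have hlarge : ∀ᶠ n : ℕ in atTop, M < n * c :=
    (tendsto_natCast_atTop_atTop.atTop_mul_const hc).eventually_gt_atTop M
  refine tendsto_of_tendsto_of_tendsto_of_le_of_le' tendsto_const_nhds hlim
    (Eventually.of_forall fun _ => zero_le) ?_
  filter_upwards [hlarge] with n hn
  have hsub : {ω | S n ω ≤ M} ⊆ {ω | ε < Real.sqrt (∑ i, (qhat n ω i - q i) ^ 2)} ∪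
      ⋃ i, ⋃ j, {ω | ε < |Ehat n ω i j - E i j|} := by
    intro ω hω
    by_contra hgood
    simp only [Set.mem_union, Set.mem_iUnion, Set.mem_ofPred_eq, not_or, not_exists,
      not_lt] at hgood
    refine (show S n ω ≤ M from hω).not_gt (hn.trans_le ?_)
    rw [hS]
    exact mul_le_mul_of_nonneg_left (hlow _ _ hgood.1 hgood.2).le n.cast_nonneg
  calc P {ω | S n ω ≤ M}
      ≤ _ := (measure_mono hsub).trans (measure_union_le _ _)
    _ ≤ _ := by
      gcongr
      refine (measure_iUnion_fintype_le P _).trans ?_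
      gcongr
      exact measure_iUnion_fintype_le P _
end
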